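/- For k ∈ ℂ \ [-1,1] approaching 1, the function k ∫_0^1 log(1-s)²/(s²-k²) ds tends to (1/2)log²(k-1) + π²/6 + ∫_0^1 log λ/(λ-2) dλ + o(1), where log is the principal branch. -/

import Mathlib

open Complex Filter intervalIntegral

open MeasureTheory Topology

lemma hasDerivAt_pow_succ_mul_log (n : ℕ) {t : ℝ} (ht : t ≠ 0) :
    HasDerivAt (fun t : ℝ => t ^ (n + 1) / (n + 1) * Real.log t - t ^ (n + 1) / (n + 1) ^ 2)
      (t ^ n * Real.log t) t := by
  have hn : (n : ℝ) + 1 ≠ 0 := by positivity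
  have hp := hasDerivAt_pow (n + 1) t
  convert! ((hp.div_const ((n : ℝ) + 1)).mul (Real.hasDerivAt_log ht)).sub
    (hp.div_const (((n : ℝ) + 1) ^ 2)) using 1
  push_cast
  field_simp
  ring

lemma continuous_pow_mul_log (n : ℕ) : Continuous fun t : ℝ => t ^ (n + 1) * Real.log t := by
  simp only [pow_succ, mul_assoc]
  exact (continuous_pow n).mul Real.continuous_mul_log

lemma intervalIntegrable_pow_mul_log (n : ℕ) (a b : ℝ) :
    IntervalIntegrable (fun t : ℝ => t ^ n * Real.log t) volume a b :=
  intervalIntegrable_log'.continuousOn_mul (continuous_pow n).continuousOn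

lemma integral_pow_mul_log (n : ℕ) :
    ∫ t in (0 : ℝ)..1, t ^ n * Real.log t = -1 / ((n : ℝ) + 1) ^ 2 := by
  rw [integral_eq_sub_of_hasDerivAt_of_le zero_le_one _
    (fun t ht => hasDerivAt_pow_succ_mul_log n ht.1.ne') (intervalIntegrable_pow_mul_log n 0 1)]
  · simp [neg_div]
  · refine Continuous.continuousOn ?_
    have := continuous_pow_mul_log n
    have h2 : (fun t : ℝ => t ^ (n + 1) / (n + 1) * Real.log t - t ^ (n + 1) / (n + 1) ^ 2) =
        fun t : ℝ => (t ^ (n + 1) * Real.log t) / (n + 1) - t ^ (n + 1) / (n + 1) ^ 2 := by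
      ext t; ring
    rw [h2]
    fun_prop

lemma hasSum_neg_one_pow_div_sq :
    HasSum (fun n : ℕ => (-1 : ℝ) ^ n * (-1 / ((n : ℝ) + 1) ^ 2)) (-(Real.pi ^ 2 / 12)) := by
  have h := hasSum_one_div_nat_pow_mul_cos one_ne_zero (x := 1 / 2) (by norm_num)
  rw [← hasSum_nat_add_iff' 1] at h
  convert! h using 1
  · ext n
    rw [show 2 * Real.pi * ((n + 1 : ℕ) : ℝ) * (1 / 2) = ((n + 1 : ℕ) : ℝ) * Real.pi by ring,
      Real.cos_nat_mul_pi]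
    push_cast
    ring
  · simp [Polynomial.bernoulli, Finset.sum_range_succ]
    norm_num [Nat.choose, bernoulli, bernoulli'_two, bernoulli'_one]
    ring

lemma integral_log_div_one_add :
    ∫ t in (0 : ℝ)..1, Real.log t / (1 + t) = -(Real.pi ^ 2 / 12) := by
  have hint : ∀ n : ℕ, Integrable (fun t : ℝ => (-1) ^ n * (t ^ n * Real.log t))
      (volume.restrict (Set.Ioc 0 1)) := fun n =>
    ((intervalIntegrable_pow_mul_log n 0 1).1).const_mul _
  have hnorm : ∀ n : ℕ, ∫ t in Set.Ioc (0 : ℝ) 1, ‖(-1) ^ n * (t ^ n * Real.log t)‖ =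
      1 / ((n : ℝ) + 1) ^ 2 := by
    intro n
    rw [← neg_neg (1 / ((n : ℝ) + 1) ^ 2), ← neg_div, ← integral_pow_mul_log,
      integral_of_le zero_le_one, ← MeasureTheory.integral_neg]
    refine setIntegral_congr_fun measurableSet_Ioc fun t ht => ?_
    simp only [norm_mul, norm_pow, norm_neg, norm_one, one_pow, one_mul, Real.norm_eq_abs]
    rw [abs_of_pos ht.1, abs_of_nonpos (Real.log_nonpos ht.1.le ht.2), mul_neg]
  have hsum : Summable fun n : ℕ => 1 / ((n : ℝ) + 1) ^ 2 := by
    exact_mod_cast (summable_nat_add_iff 1).2 hasSum_zeta_two.summable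
  have h := hasSum_integral_of_summable_integral_norm hint (by simpa only [hnorm] using hsum)
  have h2 : ∀ n : ℕ, ∫ t in Set.Ioc (0 : ℝ) 1, (-1) ^ n * (t ^ n * Real.log t) =
      (-1 : ℝ) ^ n * (-1 / ((n : ℝ) + 1) ^ 2) := by
    intro n
    rw [MeasureTheory.integral_const_mul, ← integral_pow_mul_log, integral_of_le zero_le_one]
  simp only [h2] at h
  rw [← hasSum_neg_one_pow_div_sq.unique h |>.symm, integral_of_le zero_le_one,
    integral_Ioc_eq_integral_Ioo, integral_Ioc_eq_integral_Ioo]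
  refine setIntegral_congr_fun measurableSet_Ioo fun t ht => ?_
  have hg := (hasSum_geometric_of_abs_lt_one (r := -t)
    (by rw [abs_neg, abs_of_pos ht.1]; exact ht.2)).mul_right (Real.log t)
  rw [sub_neg_eq_add] at hg
  have h3 : (fun n : ℕ => (-t) ^ n * Real.log t) = fun n : ℕ => (-1) ^ n * (t ^ n * Real.log t) := by
    ext n; rw [neg_pow, mul_assoc]
  rw [h3] at hg
  simp only [hg.tsum_eq]
  ring

/-- The Stieltjes-type transform `∫_0^1 log l / (l + ε) dl`. -/
noncomputable def logTransform (ε : ℂ) : ℂ :=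
  ∫ l in (0 : ℝ)..1, (Real.log l : ℂ) / ((l : ℂ) + ε)

lemma intervalIntegrable_ofReal_log_mul {g : ℝ → ℂ} (hg : ContinuousOn g (Set.Icc 0 1)) :
    IntervalIntegrable (fun l : ℝ => (Real.log l : ℂ) * g l) volume 0 1 :=
  IntervalIntegrable.mul_continuousOn ⟨intervalIntegrable_log'.1.ofReal, intervalIntegrable_log'.2.ofReal⟩
    (by rwa [Set.uIcc_of_le zero_le_one])

lemma intervalIntegrable_log_div_add {ε : ℂ} (h : ∀ l ∈ Set.Icc (0 : ℝ) 1, (l : ℂ) + ε ≠ 0) :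
    IntervalIntegrable (fun l : ℝ => (Real.log l : ℂ) / ((l : ℂ) + ε)) volume 0 1 := by
  simp only [div_eq_mul_inv]
  exact intervalIntegrable_ofReal_log_mul (ContinuousOn.inv₀ (by fun_prop) h)

lemma hasDerivAt_logTransform {ε₀ : ℂ} {r : ℝ} (hr : 0 < r)
    (h : ∀ l ∈ Set.Icc (0 : ℝ) 1, 2 * r ≤ ‖(l : ℂ) + ε₀‖) :
    IntervalIntegrable (fun l : ℝ => -((Real.log l : ℂ) / ((l : ℂ) + ε₀) ^ 2)) volume 0 1 ∧
    HasDerivAt logTransform (∫ l in (0 : ℝ)..1, -((Real.log l : ℂ) / ((l : ℂ) + ε₀) ^ 2)) ε₀ := by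
  have hsep : ∀ ε ∈ Metric.ball ε₀ r, ∀ l ∈ Set.Icc (0 : ℝ) 1, r ≤ ‖(l : ℂ) + ε‖ := by
    intro ε hε l hl
    have h1 := norm_sub_norm_le ((l : ℂ) + ε₀) ((l : ℂ) + ε)
    rw [add_sub_add_left_eq_sub, ← dist_eq_norm, dist_comm] at h1
    linarith [h l hl, Metric.mem_ball.1 hε]
  have hne : ∀ ε ∈ Metric.ball ε₀ r, ∀ l ∈ Set.Icc (0 : ℝ) 1, (l : ℂ) + ε ≠ 0 :=
    fun ε hε l hl => norm_pos_iff.1 (hr.trans_le (hsep ε hε l hl))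
  have hsub : Set.uIoc (0 : ℝ) 1 ⊆ Set.Icc 0 1 := by
    rw [Set.uIoc_of_le zero_le_one]; exact Set.Ioc_subset_Icc_self
  have hmem := Metric.mem_ball_self (x := ε₀) hr
  refine hasDerivAt_integral_of_dominated_loc_of_deriv_le (Metric.ball_mem_nhds ε₀ hr)
    (F := fun ε l => (Real.log l : ℂ) / ((l : ℂ) + ε))
    (F' := fun ε l => -((Real.log l : ℂ) / ((l : ℂ) + ε) ^ 2))
    (bound := fun l => ‖Real.log l‖ * (r ^ 2)⁻¹) ?_ ?_ ?_ ?_ ?_ ?_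
  · refine Eventually.of_forall fun ε => Measurable.aestronglyMeasurable ?_
    fun_prop
  · exact intervalIntegrable_log_div_add (hne ε₀ hmem)
  · refine Measurable.aestronglyMeasurable ?_
    fun_prop
  · refine Eventually.of_forall fun l hl ε hε => ?_
    rw [norm_neg, norm_div, norm_pow, Complex.norm_real, div_eq_mul_inv]
    gcongr
    exact hsep ε hε l (hsub hl)
  · exact intervalIntegrable_log'.norm.mul_const _
  · refine Eventually.of_forall fun l hl ε hε => ?_
    have hd := ((hasDerivAt_id ε).const_add (l : ℂ)).inv (hne ε hε l (hsub hl))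
    convert! hd.const_mul (Real.log l : ℂ) using 1
    simp only [id]
    ring

lemma ofReal_add_mem_slitPlane {ε : ℂ} (hε : ε ∈ slitPlane) {l : ℝ} (hl : 0 ≤ l) :
    (l : ℂ) + ε ∈ slitPlane := by
  rw [mem_slitPlane_iff] at hε ⊢
  simp only [add_re, ofReal_re, add_im, ofReal_im, zero_add]
  exact hε.imp (fun h => by linarith) id

lemma exists_separation_of_mem_slitPlane {ε : ℂ} (hε : ε ∈ slitPlane) :
    ∃ r > 0, ∀ l ∈ Set.Icc (0 : ℝ) 1, 2 * r ≤ ‖(l : ℂ) + ε‖ := by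
  obtain ⟨l₀, hl₀, hmin⟩ := isCompact_Icc.exists_isMinOn (Set.nonempty_Icc.2 zero_le_one)
    (f := fun l : ℝ => ‖(l : ℂ) + ε‖) (by fun_prop)
  refine ⟨‖(l₀ : ℂ) + ε‖ / 2, half_pos (norm_pos_iff.2
    (slitPlane_ne_zero (ofReal_add_mem_slitPlane hε hl₀.1))), fun l hl => ?_⟩
  have := hmin hl
  simp only [Set.mem_ofPred_eq] at this
  linarith

lemma integral_log_div_add_sq {ε : ℂ} (hε : ε ∈ slitPlane)
    (hint : IntervalIntegrable (fun l : ℝ => -((Real.log l : ℂ) / ((l : ℂ) + ε) ^ 2)) volume 0 1) :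
    ∫ l in (0 : ℝ)..1, -((Real.log l : ℂ) / ((l : ℂ) + ε) ^ 2) =
      (log (1 + ε) - log ε) / ε := by
  have h0 := slitPlane_ne_zero hε
  have hne : ∀ l : ℝ, 0 ≤ l → (l : ℂ) + ε ≠ 0 := fun l hl =>
    slitPlane_ne_zero (ofReal_add_mem_slitPlane hε hl)
  rw [integral_eq_sub_of_hasDerivAt_of_le (f := fun l : ℝ =>
    log ((l : ℂ) + ε) / ε - ((l * Real.log l : ℝ) : ℂ) * (ε * ((l : ℂ) + ε))⁻¹) zero_le_one _ _ hint]
  · simp; ring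
  · refine ContinuousOn.sub (ContinuousOn.div_const (ContinuousOn.clog (by fun_prop)
      fun l hl => ofReal_add_mem_slitPlane hε hl.1) _) (ContinuousOn.mul ?_ (ContinuousOn.inv₀
      (by fun_prop) fun l hl => mul_ne_zero h0 (hne l hl.1)))
    exact (continuous_ofReal.comp Real.continuous_mul_log).continuousOn
  · intro l hl
    have hl0 := hne l hl.1.le
    have hadd : HasDerivAt (fun l : ℝ => (l : ℂ) + ε) 1 l :=
      (Complex.ofRealCLM.hasDerivAt (x := l)).add_const ε
    have hlog := (hadd.clog_real (ofReal_add_mem_slitPlane hε hl.1.le)).div_const ε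
    have hml := (Real.hasDerivAt_mul_log hl.1.ne').ofReal_comp
    have hinv := (hadd.const_mul ε).inv (mul_ne_zero h0 hl0)
    convert! hlog.sub (hml.mul hinv) using 1
    simp only [Pi.inv_apply]
    push_cast
    field_simp
    ring

lemma hasDerivAt_logTransform_add {ε : ℂ} (hε : ε ∈ slitPlane) :
    HasDerivAt (fun ε => logTransform ε + (1 / 2) * log ε ^ 2) (log (1 + ε) / ε) ε := by
  obtain ⟨r, hr, h⟩ := exists_separation_of_mem_slitPlane hε
  obtain ⟨hint, hd⟩ := hasDerivAt_logTransform hr h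
  rw [integral_log_div_add_sq hε hint] at hd
  have h0 := slitPlane_ne_zero hε
  convert! hd.add (((hasDerivAt_log hε).pow 2).const_mul (1 / 2)) using 1
  field_simp
  push_cast
  ring

lemma hasDerivAt_logTransform_add_sub_log_mul_log {t : ℝ} (ht : 0 < t) :
    HasDerivAt (fun t : ℝ => logTransform t + (1 / 2) * log (t : ℂ) ^ 2 -
      ((Real.log t * Real.log (1 + t) : ℝ) : ℂ)) ((-(Real.log t / (1 + t)) : ℝ) : ℂ) t := by
  have h1 : 1 + t ≠ 0 := by positivity
  have hd := (hasDerivAt_logTransform_add (ofReal_mem_slitPlane.2 ht)).comp_ofReal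
  have hl := ((Real.hasDerivAt_log ht.ne').mul
    (((hasDerivAt_id t).const_add 1).log h1)).ofReal_comp
  convert! hd.sub hl using 1
  have h1' : (1 : ℂ) + t ≠ 0 := by exact_mod_cast h1
  have ht' : (t : ℂ) ≠ 0 := by exact_mod_cast ht.ne'
  have hlog : log (1 + (t : ℂ)) = (Real.log (1 + t) : ℂ) := by
    rw [ofReal_log (by positivity)]; push_cast; rfl
  rw [hlog]
  push_cast
  simp only [id]
  field_simp
  ring

lemma intervalIntegrable_log_div_one_add :
    IntervalIntegrable (fun t : ℝ => Real.log t / (1 + t)) volume 0 1 := by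
  simp only [div_eq_mul_inv]
  refine intervalIntegrable_log'.mul_continuousOn (ContinuousOn.inv₀ (by fun_prop) fun t ht => ?_)
  rw [Set.uIcc_of_le zero_le_one] at ht
  linarith [ht.1]

lemma logTransform_one : logTransform 1 = ((-(Real.pi ^ 2 / 12) : ℝ) : ℂ) := by
  rw [← integral_log_div_one_add, ← intervalIntegral.integral_ofReal, logTransform]
  simp [add_comm]

lemma logTransform_ofReal_add {t : ℝ} (ht : 0 < t) (ht1 : t ≤ 1) :
    logTransform t + (1 / 2) * log (t : ℂ) ^ 2 =
      ((-(Real.pi ^ 2 / 12) + (∫ u in t..1, Real.log u / (1 + u)) +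
        Real.log t * Real.log (1 + t) : ℝ) : ℂ) := by
  have hsub : Set.uIcc t 1 ⊆ Set.uIcc 0 1 := by
    rw [Set.uIcc_of_le ht1, Set.uIcc_of_le zero_le_one]
    exact Set.Icc_subset_Icc_left ht.le
  have hint := (intervalIntegrable_log_div_one_add.mono_set hsub).neg
  have h := integral_eq_sub_of_hasDerivAt
    (fun u hu => hasDerivAt_logTransform_add_sub_log_mul_log
      (ht.trans_le (Set.uIcc_of_le ht1 ▸ hu).1)) (⟨hint.1.ofReal, hint.2.ofReal⟩)
  rw [intervalIntegral.integral_ofReal, intervalIntegral.integral_neg] at h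
  simp only [ofReal_one, logTransform_one, log_one, Real.log_one] at h
  push_cast at h ⊢
  linear_combination h

lemma tendsto_log_mul_log_one_add :
    Tendsto (fun t : ℝ => Real.log t * Real.log (1 + t)) (𝓝[>] 0) (𝓝 0) := by
  have h0 : Tendsto (fun t : ℝ => ‖t * Real.log t‖) (𝓝[>] 0) (𝓝 0) := by
    have := (Real.continuous_mul_log.tendsto 0).norm
    simp only [zero_mul, norm_zero] at this
    exact this.mono_left nhdsWithin_le_nhds
  refine squeeze_zero_norm' ?_ h0
  filter_upwards [self_mem_nhdsWithin] with t ht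
  have ht0 : 0 < t := ht
  rw [norm_mul, norm_mul, mul_comm]
  gcongr
  rw [Real.norm_of_nonneg (Real.log_nonneg (by linarith)), Real.norm_of_nonneg ht0.le]
  linarith [Real.log_le_sub_one_of_pos (show 0 < 1 + t by linarith)]

lemma tendsto_logTransform_ofReal_add :
    Tendsto (fun t : ℝ => logTransform t + (1 / 2) * log (t : ℂ) ^ 2) (𝓝[>] 0)
      (𝓝 (-((Real.pi : ℂ) ^ 2 / 6))) := by
  have hprim := continuousOn_primitive_interval_left
    (f := fun u : ℝ => Real.log u / (1 + u)) (a := 0) (b := 1) (μ := volume)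
    ((intervalIntegrable_iff_integrableOn_Icc_of_le zero_le_one (by simp)).1
      intervalIntegrable_log_div_one_add |>.mono_set (Set.uIcc_of_le zero_le_one).le)
  have hprim0 := (hprim 0 Set.left_mem_uIcc).tendsto.mono_left
    (nhdsWithin_le_of_mem (show Set.uIcc (0 : ℝ) 1 ∈ 𝓝[>] 0 by
      rw [Set.uIcc_of_le zero_le_one]; exact Icc_mem_nhdsGT zero_lt_one))
  rw [integral_log_div_one_add] at hprim0
  have h := (hprim0.const_add (-(Real.pi ^ 2 / 12))).add tendsto_log_mul_log_one_add
  have h' := (continuous_ofReal.tendsto _).comp h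
  rw [show ((-(Real.pi ^ 2 / 12) + -(Real.pi ^ 2 / 12) + 0 : ℝ) : ℂ) = -((Real.pi : ℂ) ^ 2 / 6) by
    push_cast; ring] at h'
  refine h'.congr' ?_
  filter_upwards [Ioc_mem_nhdsGT zero_lt_one] with t ht
  exact (logTransform_ofReal_add ht.1 ht.2).symm

lemma segment_norm_subset_slitPlane {ε : ℂ} (hε : ε ∈ slitPlane) :
    segment ℝ ε (‖ε‖ : ℂ) ⊆ slitPlane := by
  have hn : 0 < ‖ε‖ := norm_pos_iff.2 (slitPlane_ne_zero hε)
  rintro z ⟨a, b, ha, hb, hab, rfl⟩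
  rw [mem_slitPlane_iff] at hε ⊢
  simp only [add_re, real_smul, mul_re, ofReal_re, ofReal_im, zero_mul, sub_zero, add_im, mul_im,
    mul_zero, add_zero]
  rcases ha.eq_or_lt with rfl | ha
  · left
    have : b = 1 := by linarith
    simpa [this] using slitPlane_ne_zero (mem_slitPlane_iff.2 hε)
  · rcases hε with h | h
    · left; positivity
    · right; exact mul_ne_zero ha.ne' h

lemma norm_logTransform_add_sub_le {ε : ℂ} (hε : ε ∈ slitPlane) (hε2 : ‖ε‖ ≤ 1 / 2) :
    ‖(logTransform ε + (1 / 2) * log ε ^ 2) -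
      (logTransform (‖ε‖ : ℂ) + (1 / 2) * log (‖ε‖ : ℂ) ^ 2)‖ ≤ 3 * ‖ε‖ := by
  have hball : segment ℝ ε (‖ε‖ : ℂ) ⊆ Metric.closedBall 0 ‖ε‖ :=
    (convex_closedBall (0 : ℂ) ‖ε‖).segment_subset (by simp) (by simp)
  have h := (convex_segment (𝕜 := ℝ) ε (‖ε‖ : ℂ)).norm_image_sub_le_of_norm_hasDerivWithin_le
    (𝕜 := ℂ) (C := 3 / 2)
    (fun z hz => (hasDerivAt_logTransform_add
      (segment_norm_subset_slitPlane hε hz)).hasDerivWithinAt)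
    (fun z hz => ?_) (right_mem_segment ℝ ε (‖ε‖ : ℂ)) (left_mem_segment ℝ ε (‖ε‖ : ℂ))
  · refine h.trans ?_
    have := norm_sub_le ε (‖ε‖ : ℂ)
    rw [norm_real, norm_norm] at this
    linarith
  · have hz0 : 0 < ‖z‖ :=
      norm_pos_iff.2 (slitPlane_ne_zero (segment_norm_subset_slitPlane hε hz))
    rw [norm_div, div_le_iff₀ hz0]
    exact norm_log_one_add_half_le_self ((mem_closedBall_zero_iff.1 (hball hz)).trans hε2)

/-- As `ε → 0` in the slit plane, `∫_0^1 log l / (l + ε) dl + (1/2) log² ε → -π²/6`. -/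
lemma tendsto_logTransform_add :
    Tendsto (fun ε : ℂ => logTransform ε + (1 / 2) * log ε ^ 2) (𝓝[slitPlane] 0)
      (𝓝 (-((Real.pi : ℂ) ^ 2 / 6))) := by
  have hnorm : Tendsto (fun ε : ℂ => ‖ε‖) (𝓝[slitPlane] 0) (𝓝 0) :=
    (continuous_norm.tendsto' (0 : ℂ) 0 norm_zero).mono_left nhdsWithin_le_nhds
  have hpos : Tendsto (fun ε : ℂ => ‖ε‖) (𝓝[slitPlane] 0) (𝓝[>] 0) :=
    tendsto_nhdsWithin_iff.2 ⟨hnorm, by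
      filter_upwards [self_mem_nhdsWithin] with ε hε
      exact norm_pos_iff.2 (slitPlane_ne_zero hε)⟩
  have hdiff : Tendsto (fun ε : ℂ => (logTransform ε + (1 / 2) * log ε ^ 2) -
      (logTransform (‖ε‖ : ℂ) + (1 / 2) * log (‖ε‖ : ℂ) ^ 2)) (𝓝[slitPlane] 0) (𝓝 0) := by
    refine squeeze_zero_norm' ?_ (by simpa using hnorm.const_mul 3)
    filter_upwards [self_mem_nhdsWithin, hnorm.eventually_le_const (show (0 : ℝ) < 1 / 2 by norm_num)]
      with ε hε hε2
    exact norm_logTransform_add_sub_le hε hε2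
  simpa using hdiff.add (tendsto_logTransform_ofReal_add.comp hpos)

lemma mul_integral_log_sq_div {k : ℂ} (hk : k - 1 ∈ slitPlane) (hk0 : 0 < k.re) :
    k * (∫ s in (0 : ℝ)..1, (Real.log ((1 - s) ^ 2) : ℂ) / ((s : ℂ) ^ 2 - k ^ 2)) =
      logTransform (-1 - k) - logTransform (k - 1) := by
  have ha : ∀ l ∈ Set.Icc (0 : ℝ) 1, (l : ℂ) + (k - 1) ≠ 0 := fun l hl =>
    slitPlane_ne_zero (ofReal_add_mem_slitPlane hk hl.1)
  have hb : ∀ l ∈ Set.Icc (0 : ℝ) 1, (l : ℂ) + (-1 - k) ≠ 0 := fun l hl h0 => by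
    have := congrArg re h0
    simp at this
    linarith [hl.2]
  have hsubst := integral_comp_sub_left (a := 0) (b := 1)
    (fun s : ℝ => (Real.log ((1 - s) ^ 2) : ℂ) / ((s : ℂ) ^ 2 - k ^ 2)) 1
  rw [sub_self, sub_zero] at hsubst
  rw [← hsubst, logTransform, logTransform, ← intervalIntegral.integral_sub
    (intervalIntegrable_log_div_add hb) (intervalIntegrable_log_div_add ha),
    ← intervalIntegral.integral_const_mul]
  refine integral_congr fun l hl => ?_
  rw [Set.uIcc_of_le zero_le_one] at hl
  have hfac : ((1 - l : ℝ) : ℂ) ^ 2 - k ^ 2 = ((l : ℂ) + (-1 - k)) * ((l : ℂ) + (k - 1)) := by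
    push_cast; ring
  simp only [sub_sub_cancel, Real.log_pow, hfac]
  have ha' := ha l hl
  have hb' := hb l hl
  rw [div_sub_div _ _ hb' ha', mul_div_assoc']
  push_cast
  ring

lemma continuousAt_logTransform_neg_two : ContinuousAt logTransform (-2) := by
  refine (hasDerivAt_logTransform (r := 1 / 2) (by norm_num) fun l hl => ?_).2.continuousAt
  have h := abs_re_le_norm ((l : ℂ) + -2)
  have h2 := neg_le_abs ((l : ℂ) + -2).re
  simp only [add_re, neg_re, ofReal_re, re_ofNat] at h h2
  linarith [hl.2]

lemma sub_one_mem_slitPlane {k : ℂ} (hk : k ∉ (fun s : ℝ => (s : ℂ)) '' Set.Icc (-1) 1)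
    (hk0 : 0 < k.re) : k - 1 ∈ slitPlane := by
  by_contra h
  rw [mem_slitPlane_iff] at h
  simp only [sub_re, one_re, sub_im, one_im, sub_zero, not_or, not_lt, not_not] at h
  exact hk ⟨k.re, ⟨by linarith, by linarith [h.1]⟩, Complex.ext rfl h.2.symm⟩

/-- `k ∫_0^1 log(1-s)²/(s²-k²) ds → (1/2)log²(k-1) + π²/6 + ∫_0^1 log λ/(λ-2) dλ + o(1)`
as `k → 1` with `k ∉ [-1,1]`. -/
theorem singular_part_asymptotics :
    Tendsto
      (fun k : ℂ =>
        k * (∫ s in (0 : ℝ)..1, (Real.log ((1 - s) ^ 2) : ℂ) / ((s : ℂ) ^ 2 - k ^ 2)) -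
          ((1 / 2) * (Complex.log (k - 1)) ^ 2 + (Real.pi : ℂ) ^ 2 / 6 +
            ∫ l in (0 : ℝ)..1, (Real.log l : ℂ) / ((l : ℂ) - 2)))
      (nhdsWithin 1 {k : ℂ | k ∉ (fun s : ℝ => (s : ℂ)) '' Set.Icc (-1) 1})
      (nhds 0) := by
  have hre : ∀ᶠ k in nhdsWithin (1 : ℂ) {k : ℂ | k ∉ (fun s : ℝ => (s : ℂ)) '' Set.Icc (-1) 1},
      0 < k.re :=
    nhdsWithin_le_nhds (continuous_re.continuousAt.eventually_const_lt (by simp))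
  have hshift : Tendsto (fun k : ℂ => k - 1)
      (nhdsWithin 1 {k : ℂ | k ∉ (fun s : ℝ => (s : ℂ)) '' Set.Icc (-1) 1})
      (𝓝[slitPlane] 0) := by
    refine tendsto_nhdsWithin_iff.2 ⟨?_, ?_⟩
    · exact ((continuous_sub_right (1 : ℂ)).tendsto' 1 0 (sub_self 1)).mono_left nhdsWithin_le_nhds
    · filter_upwards [self_mem_nhdsWithin, hre] with k hk hk0
      exact sub_one_mem_slitPlane hk hk0
  have hreg : Tendsto (fun k : ℂ => logTransform (-1 - k))
      (nhdsWithin 1 {k : ℂ | k ∉ (fun s : ℝ => (s : ℂ)) '' Set.Icc (-1) 1})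
      (𝓝 (logTransform (-2))) :=
    continuousAt_logTransform_neg_two.tendsto.comp
      ((Continuous.tendsto' (by fun_prop) 1 (-2) (by norm_num)).mono_left nhdsWithin_le_nhds)
  have h := (hreg.sub_const (logTransform (-2))).sub
    ((tendsto_logTransform_add.comp hshift).add_const ((Real.pi : ℂ) ^ 2 / 6))
  rw [sub_self, neg_add_cancel, sub_self] at h
  refine h.congr' ?_
  filter_upwards [self_mem_nhdsWithin, hre] with k hk hk0
  have hconst : ∫ l in (0 : ℝ)..1, (Real.log l : ℂ) / ((l : ℂ) - 2) = logTransform (-2) := by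
    simp only [logTransform, sub_eq_add_neg]
  rw [mul_integral_log_sq_div (sub_one_mem_slitPlane hk hk0) hk0, hconst, Function.comp_apply]
  ring
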